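/- Let q > 2 be a prime power, let q + ε be the size of the smallest non-trivial blocking set in PG(2,q), and let N ≥ 3 be odd. If S is a maximal partial line spread of PG(N,q) with deficiency δ satisfying 0 < δ < ε, then a contradiction follows; that is, there exist no maximal partial line spreads of PG(N,q) of deficiency δ with 0 < δ < ε. -/

import Mathlib

/-- A partial line spread of PG(n-1, q): a set of lines (2-dimensional linear
subspaces of `F^n`) that are pairwise skew, i.e. pairwise intersecting only
in the zero subspace. -/
def IsPartialLineSpread (F : Type*) [Field F] (n : ℕ)
    (S : Set (Submodule F (Fin n → F))) : Prop :=
  (∀ l ∈ S, Module.finrank F ↥l = 2) ∧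
  (∀ l ∈ S, ∀ l' ∈ S, l ≠ l' → l ⊓ l' = ⊥)

/-- A maximal partial line spread: a partial line spread such that every line
of the space meets some line of the spread nontrivially (equivalently, it
cannot be extended to a larger partial line spread). -/
def IsMaximalPartialLineSpread (F : Type*) [Field F] (n : ℕ)
    (S : Set (Submodule F (Fin n → F))) : Prop :=
  IsPartialLineSpread F n S ∧
  ∀ m : Submodule F (Fin n → F), Module.finrank F ↥m = 2 → ∃ l ∈ S, m ⊓ l ≠ ⊥

/-- A blocking set of PG(2,q): a set of points (1-dimensional subspaces of
`F^3`) meeting every line (2-dimensional subspace of `F^3`). -/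
def IsBlockingSet (F : Type*) [Field F] (B : Set (Submodule F (Fin 3 → F))) : Prop :=
  (∀ P ∈ B, Module.finrank F ↥P = 1) ∧
  ∀ l : Submodule F (Fin 3 → F), Module.finrank F ↥l = 2 → ∃ P ∈ B, P ≤ l

/-- A non-trivial blocking set of PG(2,q): a blocking set containing no line
entirely, i.e. not containing all the points of any line. -/
def IsNontrivialBlockingSet (F : Type*) [Field F]
    (B : Set (Submodule F (Fin 3 → F))) : Prop :=
  IsBlockingSet F B ∧
  ¬ ∃ l : Submodule F (Fin 3 → F), Module.finrank F ↥l = 2 ∧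
      ∀ P : Submodule F (Fin 3 → F), Module.finrank F ↥P = 1 → P ≤ l → P ∈ B

open Module

section VectorCones

variable {F : Type*} [Field F]

theorem ncard_coe_submodule [Fintype F] {V : Type*} [AddCommGroup V] [Module F V]
    [FiniteDimensional F V] (W : Submodule F V) :
    (W : Set V).ncard = Fintype.card F ^ finrank F W := by
  rw [← Nat.card_coe_set_eq, ← Nat.card_eq_fintype_card]
  exact Module.natCard_eq_pow_finrank (K := F) (V := W)

theorem finrank_comap_mkQ {V : Type*} [AddCommGroup V] [Module F V] [FiniteDimensional F V]
    (U : Submodule F V) (W : Submodule F (V ⧸ U)) :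
    finrank F (W.comap U.mkQ) = finrank F W + finrank F U := by
  have h := LinearMap.finrank_range_add_finrank_ker (U.mkQ.domRestrict (W.comap U.mkQ))
  rw [LinearMap.range_domRestrict, Submodule.map_comap_eq_of_surjective U.mkQ_surjective,
    LinearMap.ker_domRestrict, Submodule.ker_mkQ,
    (Submodule.comapSubtypeEquivOfLe (U.le_comap_mkQ W)).finrank_eq] at h
  exact h.symm

theorem finrank_quotient_eq {V : Type*} [AddCommGroup V] [Module F V] [FiniteDimensional F V]
    (U : Submodule F V) {n k : ℕ}
    (hV : finrank F V = n + k) (hU : finrank F U = k) :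
    finrank F (V ⧸ U) = n := by
  have := U.finrank_quotient_add_finrank
  omega

theorem ncard_diff_zero [Fintype F] {V : Type*} [AddCommGroup V] [Module F V]
    [FiniteDimensional F V] (W : Submodule F V) :
    ((W : Set V) \ {0}).ncard = Fintype.card F ^ finrank F W - 1 := by
  have := Module.finite_of_finite F (M := V)
  rw [Set.ncard_sdiff (by simp), ncard_coe_submodule, Set.ncard_singleton]

theorem exists_ne_zero_notMem [Fintype F] {V : Type*} [AddCommGroup V] [Module F V]
    [FiniteDimensional F V] (T : Set V) (hT : T.ncard < Fintype.card F ^ finrank F V - 1) :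
    ∃ v, v ≠ 0 ∧ v ∉ T := by
  have := Module.finite_of_finite F (M := V)
  by_contra! h
  have h1 := ncard_diff_zero (⊤ : Submodule F V)
  have h2 := Set.ncard_le_ncard (s := ((⊤ : Submodule F V) : Set V) \ {0}) (t := T)
    (fun v hv => h v (by simpa using hv))
  rw [finrank_top] at h1
  omega

/-- A set of vectors avoiding zero and stable under nonzero scalars: the vector form of a set of
points of the projective space. -/
structure IsPointCone (F : Type*) [Field F] {V : Type*} [AddCommGroup V] [Module F V]
    (T : Set V) : Prop where
  zero_notMem : (0 : V) ∉ T
  smul_mem : ∀ (a : F) (v : V), a ≠ 0 → v ∈ T → a • v ∈ T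

namespace IsPointCone

variable {V : Type*} [AddCommGroup V] [Module F V] {T : Set V}

theorem smul_mem_iff (hT : IsPointCone F T) {a : F} (ha : a ≠ 0) {v : V} :
    a • v ∈ T ↔ v ∈ T := by
  refine ⟨fun h => ?_, hT.smul_mem a v ha⟩
  simpa [smul_smul, inv_mul_cancel₀ ha] using hT.smul_mem a⁻¹ _ (inv_ne_zero ha) h

theorem image_mkQ (hT : IsPointCone F T) (U : Submodule F V) (hU : ∀ v ∈ T, v ∉ U) :
    IsPointCone F (U.mkQ '' T) where
  zero_notMem := by
    rintro ⟨v, hv, h⟩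
    exact hU v hv (by simpa using h)
  smul_mem := by
    rintro a _ ha ⟨v, hv, rfl⟩
    exact ⟨a • v, hT.smul_mem a v ha hv, by simp⟩

theorem notMem_span_singleton (hT : IsPointCone F T) {x : V} (hx : x ∉ T) :
    ∀ v ∈ T, v ∉ Submodule.span F {x} := by
  intro v hv hvx
  obtain ⟨a, rfl⟩ := Submodule.mem_span_singleton.1 hvx
  rcases eq_or_ne a 0 with rfl | ha
  · exact hT.zero_notMem (by simpa using hv)
  · exact hx ((hT.smul_mem_iff ha).1 hv)

/-- A cone with fewer than `q ^ (c + 1) - 1` vectors misses some subspace of codimension `c`. -/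
theorem exists_submodule_avoiding [Fintype F] (c n : ℕ) : ∀ {V : Type*} [AddCommGroup V]
    [Module F V] [FiniteDimensional F V] {T : Set V}, IsPointCone F T → finrank F V = n + c →
    T.ncard < Fintype.card F ^ (c + 1) - 1 →
    ∃ E : Submodule F V, finrank F E = n ∧ ∀ v ∈ T, v ∉ E := by
  induction n with
  | zero =>
    intro V _ _ _ T hT _ _
    refine ⟨⊥, by simp, fun v hv h => hT.zero_notMem ?_⟩
    rwa [← (Submodule.mem_bot F).1 h]
  | succ n ih =>
    intro V _ _ _ T hT hV hcard
    have := Module.finite_of_finite F (M := V)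
    obtain ⟨x, hx0, hxT⟩ := exists_ne_zero_notMem (F := F) T (by
      refine hcard.trans_le (Nat.sub_le_sub_right (Nat.pow_le_pow_right Fintype.card_pos ?_) 1)
      omega)
    have hx1 : finrank F (Submodule.span F {x}) = 1 := finrank_span_singleton hx0
    obtain ⟨E, hE, hTE⟩ := ih (hT.image_mkQ (Submodule.span F {x}) (hT.notMem_span_singleton hxT))
      (finrank_quotient_eq _ (by omega) hx1) ((Set.ncard_image_le).trans_lt hcard)
    refine ⟨E.comap (Submodule.span F {x}).mkQ, ?_, fun v hv h => hTE _ ⟨v, hv, rfl⟩ h⟩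
    rw [finrank_comap_mkQ, hE, hx1]

theorem card_sub_one_mul_ncard_image_span_le [Fintype F] [FiniteDimensional F V]
    (hT : IsPointCone F T) :
    (Fintype.card F - 1) * ((fun v => Submodule.span F {v}) '' T).ncard ≤ T.ncard := by
  classical
  have := Module.finite_of_finite F (M := V)
  have := Fintype.ofFinite V
  rw [Set.ncard_eq_toFinset_card' T, Set.ncard_eq_toFinset_card', Set.toFinset_image]
  refine Finset.mul_card_image_le_card T.toFinset _ fun L hL => ?_
  obtain ⟨v, hv, rfl⟩ := Finset.mem_image.1 hL
  rw [Set.mem_toFinset] at hv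
  have hv0 : v ≠ 0 := fun h => hT.zero_notMem (h ▸ hv)
  have h1 := ncard_diff_zero (Submodule.span F {v})
  rw [finrank_span_singleton hv0, pow_one] at h1
  rw [← h1, Set.ncard_eq_toFinset_card']
  refine Finset.card_le_card fun u hu => ?_
  obtain ⟨hu, hu0⟩ : u ∈ Submodule.span F {v} ∧ u ≠ 0 := by simpa using hu
  obtain ⟨a, rfl⟩ := Submodule.mem_span_singleton.1 hu
  have ha : a ≠ 0 := fun h => hu0 (by simp [h])
  simp only [Finset.mem_filter, Set.mem_toFinset]
  exact ⟨hT.smul_mem a v ha hv, Submodule.span_singleton_smul_eq ha.isUnit v⟩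

theorem exists_line_of_finrank_eq_three [Fintype F] [FiniteDimensional F V] {m : ℕ}
    (hm : ∀ B : Set (Submodule F (Fin 3 → F)), IsNontrivialBlockingSet F B → m ≤ B.ncard)
    (hT : IsPointCone F T) (hV : finrank F V = 3)
    (hblock : ∀ E : Submodule F V, finrank F E = 2 → ∃ v ∈ T, v ∈ E)
    (hcard : T.ncard < (Fintype.card F - 1) * m) :
    ∃ W : Submodule F V, finrank F W = 2 ∧ ∀ v ∈ W, v ≠ 0 → v ∈ T := by
  have := Module.finite_of_finite F (M := V)
  let e : V ≃ₗ[F] (Fin 3 → F) := LinearEquiv.ofFinrankEq _ _ (by simp [hV])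
  have heT : IsPointCone F (e '' T) := by
    refine ⟨?_, ?_⟩
    · rintro ⟨v, hv, h⟩
      exact hT.zero_notMem (by rwa [← (map_eq_zero_iff e e.injective).1 h])
    · rintro a _ ha ⟨v, hv, rfl⟩
      exact ⟨a • v, hT.smul_mem a v ha hv, by simp⟩
  let B : Set (Submodule F (Fin 3 → F)) := (fun v => Submodule.span F {v}) '' (e '' T)
  have hB : IsBlockingSet F B := by
    refine ⟨?_, fun l hl => ?_⟩
    · rintro _ ⟨u, hu, rfl⟩
      exact finrank_span_singleton fun h => heT.zero_notMem (h ▸ hu)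
    · obtain ⟨v, hv, hvl⟩ := hblock (l.map e.symm.toLinearMap)
        (by rw [LinearEquiv.finrank_map_eq, hl])
      obtain ⟨u, hu, rfl⟩ := hvl
      refine ⟨_, ⟨u, ⟨_, hv, by simp⟩, rfl⟩, ?_⟩
      simpa using hu
  have hBcard : B.ncard < m := by
    have h1 := heT.card_sub_one_mul_ncard_image_span_le
    have h2 : (e '' T).ncard ≤ T.ncard := Set.ncard_image_le
    exact lt_of_mul_lt_mul_left (h1.trans_lt (h2.trans_lt hcard)) (Nat.zero_le _)
  have hnt : ¬ IsNontrivialBlockingSet F B := fun h => (hm B h).not_gt hBcard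
  simp only [IsNontrivialBlockingSet, hB, true_and, not_not] at hnt
  obtain ⟨l, hl, hlB⟩ := hnt
  refine ⟨l.map e.symm.toLinearMap, by rw [LinearEquiv.finrank_map_eq, hl], ?_⟩
  rintro _ ⟨u, hu, rfl⟩ hu0
  have hu0 : u ≠ 0 := fun h => hu0 (by simp [h])
  have huB := hlB (Submodule.span F {u}) (finrank_span_singleton hu0) (by simpa using hu)
  by_contra hcon
  obtain ⟨w, hw, hwu⟩ := huB
  have huT : u ∉ e '' T := by
    rintro ⟨v, hv, rfl⟩
    exact hcon (by simpa using hv)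
  refine heT.notMem_span_singleton huT w hw ?_
  have : Submodule.span F {w} = Submodule.span F {u} := hwu
  rw [← this]
  exact Submodule.mem_span_singleton_self w

theorem comap_subtype (hT : IsPointCone F T) (W : Submodule F V) :
    IsPointCone F (W.subtype ⁻¹' T) where
  zero_notMem := by simpa using hT.zero_notMem
  smul_mem a v ha hv := by simpa using hT.smul_mem a v ha hv

theorem ncard_preimage_subtype (T : Set V) (W : Submodule F V) :
    (W.subtype ⁻¹' T).ncard = (T ∩ W).ncard := by
  rw [← Set.ncard_image_of_injective _ W.injective_subtype, Set.image_preimage_eq_inter_range]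
  simp

/-- A cone that meets all hyperplanes and has fewer points than any non-trivial planar blocking
set contains a line. -/
theorem exists_line_of_blocks_hyperplanes [Fintype F] {ε : ℕ}
    (hm : ∀ B : Set (Submodule F (Fin 3 → F)), IsNontrivialBlockingSet F B →
      Fintype.card F + ε ≤ B.ncard) (hε : ε ≤ Fintype.card F) (n : ℕ) :
    ∀ {V : Type*} [AddCommGroup V] [Module F V] [FiniteDimensional F V] {T : Set V},
    IsPointCone F T → finrank F V = n + 3 →
    (∀ E : Submodule F V, finrank F E = n + 2 → ∃ v ∈ T, v ∈ E) →
    T.ncard < (Fintype.card F - 1) * (Fintype.card F + ε) →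
    ∃ W : Submodule F V, finrank F W = 2 ∧ ∀ v ∈ W, v ≠ 0 → v ∈ T := by
  induction n with
  | zero =>
    intro V _ _ _ T hT hV hblock hcard
    exact hT.exists_line_of_finrank_eq_three hm (by omega) (by simpa using hblock) hcard
  | succ n ih =>
    intro V _ _ _ T hT hV hblock hcard
    have := Module.finite_of_finite F (M := V)
    have hq : 1 < Fintype.card F := Fintype.one_lt_card
    obtain ⟨r, hr⟩ : ∃ r, Fintype.card F = r + 1 := ⟨_, (Nat.succ_pred_eq_of_pos (by omega)).symm⟩
    rw [hr, Nat.add_sub_cancel] at hcard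
    have hεr : ε ≤ r + 1 := hr ▸ hε
    obtain ⟨x, hx0, hxT⟩ := exists_ne_zero_notMem (F := F) T (by
      have : Fintype.card F ^ 3 ≤ Fintype.card F ^ finrank F V :=
        Nat.pow_le_pow_right Fintype.card_pos (by omega)
      have h2 : r * (r + 1 + ε) ≤ (r + 1) ^ 3 - 1 := by
        apply Nat.le_sub_one_of_lt
        nlinarith [Nat.mul_le_mul_left r hεr]
      rw [hr] at this ⊢
      omega)
    let U := Submodule.span F {x}
    have hU : finrank F U = 1 := finrank_span_singleton hx0
    obtain ⟨W, hW, hWT⟩ := ih (hT.image_mkQ U (hT.notMem_span_singleton hxT))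
      (finrank_quotient_eq _ (by omega) hU)
      (fun E hE => by
        obtain ⟨v, hv, hvE⟩ := hblock (E.comap U.mkQ) (by rw [finrank_comap_mkQ, hE, hU])
        exact ⟨_, ⟨v, hv, rfl⟩, hvE⟩)
      (by rw [hr, Nat.add_sub_cancel]; exact (Set.ncard_image_le).trans_lt hcard)
    let P := W.comap U.mkQ
    have hP : finrank F P = 3 := by rw [finrank_comap_mkQ, hW, hU]
    have hTP : r * (r + 2) ≤ (T ∩ P).ncard := by
      have h1 := ncard_diff_zero W
      have h2 : ((W : Set (V ⧸ U)) \ {0}).ncard ≤ (U.mkQ '' (T ∩ P)).ncard := by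
        refine Set.ncard_le_ncard fun w hw => ?_
        obtain ⟨v, hv, rfl⟩ := hWT w hw.1 (by simpa using hw.2)
        exact ⟨v, ⟨hv, hw.1⟩, rfl⟩
      have h3 : (U.mkQ '' (T ∩ P)).ncard ≤ (T ∩ P).ncard := Set.ncard_image_le
      have h4 : (r + 1) ^ 2 - 1 = r * (r + 2) := by
        rw [show (r + 1) ^ 2 = r * (r + 2) + 1 by ring]; rfl
      rw [hW, hr, h4] at h1
      omega
    have hTP' : (T \ P).ncard + r * (r + 2) < r * (r + 1 + ε) := by
      have := Set.ncard_inter_add_ncard_sdiff_eq_ncard T (P : Set V)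
      omega
    obtain ⟨L, hL, hLT⟩ := (hT.comap_subtype P).exists_line_of_finrank_eq_three hm hP
      (fun M hM => by
        by_contra! hno
        let M' := M.map P.subtype
        have hM' : finrank F M' = 2 := by rw [Submodule.finrank_map_subtype_eq, hM]
        have hM'T : ∀ v ∈ T, v ∉ M' := by
          rintro _ hv ⟨u, hu, rfl⟩
          exact hno u hv hu
        let Q := P.map M'.mkQ
        have hQ : finrank F Q = 1 := by
          have h := finrank_comap_mkQ M' Q
          rw [Submodule.comap_map_mkQ, sup_eq_right.2 (Submodule.map_subtype_le P M)] at h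
          omega
        have hcone : IsPointCone F (M'.mkQ '' T ∪ ((Q : Set (V ⧸ M')) \ {0})) := by
          have h := hT.image_mkQ M' hM'T
          refine ⟨by simpa using h.zero_notMem, ?_⟩
          rintro a v ha (hv | ⟨hv, hv0⟩)
          · exact Or.inl (h.smul_mem a v ha hv)
          · exact Or.inr ⟨Q.smul_mem a hv, by simpa [ha] using hv0⟩
        have hsub : M'.mkQ '' T ∪ ((Q : Set (V ⧸ M')) \ {0}) ⊆
            M'.mkQ '' (T \ P) ∪ ((Q : Set (V ⧸ M')) \ {0}) := by
          rintro v (⟨u, hu, rfl⟩ | hv)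
          · by_cases huP : u ∈ P
            · exact Or.inr ⟨Submodule.mem_map_of_mem huP, by simpa using hM'T u hu⟩
            · exact Or.inl ⟨u, ⟨hu, huP⟩, rfl⟩
          · exact Or.inr hv
        have := Module.finite_of_finite F (M := V ⧸ M')
        obtain ⟨E, hE, hET⟩ := hcone.exists_submodule_avoiding 1 (n + 1)
          (finrank_quotient_eq _ (by omega) hM') (by
            have h1 := (Set.ncard_le_ncard hsub).trans (Set.ncard_union_le _ _)
            have h2 : (M'.mkQ '' (T \ P)).ncard ≤ (T \ P).ncard := Set.ncard_image_le
            rw [ncard_diff_zero, hQ, hr] at h1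
            rw [hr]
            apply Nat.lt_sub_of_add_lt
            rw [pow_one, Nat.add_sub_cancel] at h1
            rw [show (r + 1) ^ (1 + 1) = r * r + 2 * r + 1 by ring]
            nlinarith [Nat.mul_le_mul_left r hεr])
        obtain ⟨v, hv, hvE⟩ := hblock (E.comap M'.mkQ) (by rw [finrank_comap_mkQ, hE, hM'])
        exact hET _ (Or.inl ⟨v, hv, rfl⟩) hvE)
      (by
        rw [ncard_preimage_subtype, hr, Nat.add_sub_cancel]
        exact (Set.ncard_le_ncard Set.inter_subset_left).trans_lt hcard)
    refine ⟨L.map P.subtype, by rw [Submodule.finrank_map_subtype_eq, hL], ?_⟩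
    rintro _ ⟨u, hu, rfl⟩ hu0
    exact hLT u hu (by simpa using hu0)

end IsPointCone

theorem exists_equation_of_finrank_eq_two (l : Submodule F (Fin 3 → F)) (hl : finrank F l = 2) :
    ∃ α β γ : F, (α ≠ 0 ∨ β ≠ 0 ∨ γ ≠ 0) ∧
      ∀ v, v ∈ l ↔ v 0 * α + v 1 * β + v 2 * γ = 0 := by
  obtain ⟨f, hf, hlf⟩ := Submodule.exists_le_ker_of_lt_top l (by
    refine lt_top_iff_ne_top.2 fun h => ?_
    rw [h] at hl
    simp at hl)
  have hker : l = f.ker := by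
    refine Submodule.eq_of_le_of_finrank_le hlf ?_
    have h := LinearMap.finrank_range_add_finrank_ker f
    rw [LinearMap.range_eq_top.2 (LinearMap.surjective hf)] at h
    simp at h
    omega
  have hsum : ∀ v, f v = v 0 * f (fun j => if 0 = j then 1 else 0) +
      v 1 * f (fun j => if 1 = j then 1 else 0) + v 2 * f (fun j => if 2 = j then 1 else 0) := by
    intro v
    rw [f.pi_apply_eq_sum_univ, Fin.sum_univ_three]
    rfl
  refine ⟨_, _, _, ?_, fun v => by rw [hker, LinearMap.mem_ker, hsum]⟩
  by_contra! h
  exact hf (LinearMap.ext fun v => by simp [hsum v, h])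

/-- A line with one point `P` deleted, together with one point on each of the remaining lines
through `P`, the latter points not being collinear. -/
theorem exists_isNontrivialBlockingSet_ncard_le [Fintype F] (hq : 2 < Fintype.card F) :
    ∃ B : Set (Submodule F (Fin 3 → F)), IsNontrivialBlockingSet F B ∧
      B.ncard ≤ 2 * Fintype.card F := by
  classical
  let g : F → F := fun y => if y = 0 then 1 else 0
  let A₁ : F → Submodule F (Fin 3 → F) := fun a => Submodule.span F {![a, 1, 0]}
  let A₂ : F → Submodule F (Fin 3 → F) := fun y => Submodule.span F {![g y, y, 1]}
  refine ⟨Set.range A₁ ∪ Set.range A₂, ⟨⟨?_, fun l hl => ?_⟩, ?_⟩, ?_⟩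
  · rintro _ (⟨a, rfl⟩ | ⟨a, rfl⟩)
    · exact finrank_span_singleton fun h => by simpa using congrFun h 1
    · exact finrank_span_singleton fun h => by simpa using congrFun h 2
  · obtain ⟨α, β, γ, hne, hmem⟩ := exists_equation_of_finrank_eq_two l hl
    by_cases hα : α = 0
    · by_cases hβ : β = 0
      · refine ⟨A₁ 0, Or.inl ⟨0, rfl⟩, ?_⟩
        simp [A₁, hmem, hβ]
      · refine ⟨A₂ (-γ / β), Or.inr ⟨_, rfl⟩, ?_⟩
        simp [A₂, hmem, hα, div_mul_cancel₀ _ hβ]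
    · refine ⟨A₁ (-β / α), Or.inl ⟨_, rfl⟩, ?_⟩
      simp [A₁, hmem, div_mul_cancel₀ _ hα]
  · rintro ⟨l, hl, hlB⟩
    obtain ⟨α, β, γ, hne, hmem⟩ := exists_equation_of_finrank_eq_two l hl
    have hpt : ∀ w ∈ l, w ≠ 0 →
        (∃ a c : F, c • ![a, 1, 0] = w) ∨ ∃ y c : F, c • ![g y, y, 1] = w := by
      intro w hw hw0
      have hself := Submodule.mem_span_singleton_self (R := F) w
      rcases hlB (Submodule.span F {w}) (finrank_span_singleton hw0) (by simpa using hw) with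
        ⟨a, ha⟩ | ⟨a, ha⟩
      · rw [← ha] at hself
        exact Or.inl ⟨a, Submodule.mem_span_singleton.1 hself⟩
      · rw [← ha] at hself
        exact Or.inr ⟨a, Submodule.mem_span_singleton.1 hself⟩
    have hα : α ≠ 0 := by
      intro hα
      have h1 : (![1, 0, 0] : Fin 3 → F) ≠ 0 := fun h => by simpa using congrFun h 0
      rcases hpt ![1, 0, 0] (by simp [hmem, hα]) h1 with ⟨a, c, h⟩ | ⟨a, c, h⟩
      · have e0 := congrFun h 0
        have e1 := congrFun h 1
        simp at e0 e1
        simp [e1] at e0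
      · have e0 := congrFun h 0
        have e2 := congrFun h 2
        simp at e0 e2
        simp [e2] at e0
    have hg : ∀ y, g y * α + y * β + γ = 0 := by
      intro y
      have h1 : (![-(y * β + γ) / α, y, 1] : Fin 3 → F) ≠ 0 :=
        fun h => by simpa using congrFun h 2
      rcases hpt ![-(y * β + γ) / α, y, 1]
        (by simp [hmem, div_mul_cancel₀ _ hα]) h1 with ⟨a, c, h⟩ | ⟨a, c, h⟩
      · simpa using congrFun h 2
      · have e0 := congrFun h 0
        have e1 := congrFun h 1
        have e2 := congrFun h 2
        simp at e0 e1 e2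
        subst e2
        rw [one_mul] at e0 e1
        subst e1
        rw [e0, div_mul_cancel₀ _ hα]
        ring
    obtain ⟨c, hc⟩ : ∃ c : F, c ∉ ({0, 1} : Finset F) := by
      by_contra! h
      have h1 := Finset.card_le_card (s := Finset.univ) (t := ({0, 1} : Finset F))
        fun c _ => h c
      rw [Finset.card_univ] at h1
      exact (h1.trans Finset.card_le_two).not_gt hq
    simp only [Finset.mem_insert, Finset.mem_singleton, not_or] at hc
    have h0 := hg 0
    have h1 := hg 1
    have h2 := hg c
    simp [g, hc.1] at h0 h1 h2
    have h3 : (c - 1) * β = 0 := by linear_combination h2 - h1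
    have hβ : β = 0 := (mul_eq_zero.1 h3).resolve_left (sub_ne_zero.2 hc.2)
    apply hα
    linear_combination h0 - h1 + hβ
  · refine (Set.ncard_union_le _ _).trans ?_
    have h : ∀ A : F → Submodule F (Fin 3 → F), (Set.range A).ncard ≤ Fintype.card F := by
      intro A
      rw [← Set.image_univ, ← Nat.card_eq_fintype_card, ← Set.ncard_univ]
      exact Set.ncard_image_le
    have h1 := h A₁
    have h2 := h A₂
    omega

section HyperplanePencil

variable {V : Type*} [AddCommGroup V] [Module F V] [FiniteDimensional F V]

theorem finrank_sup_span_singleton (E : Submodule F V) {v : V} (hv : v ∉ E) :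
    finrank F ↥(E ⊔ Submodule.span F {v}) = finrank F E + 1 := by
  have hv0 : v ≠ 0 := fun h => hv (h ▸ E.zero_mem)
  have h := Submodule.finrank_sup_add_finrank_inf_eq E (Submodule.span F {v})
  rw [disjoint_iff.1 ((Submodule.disjoint_span_singleton' hv0).2 hv), finrank_bot,
    finrank_span_singleton hv0] at h
  omega

open Classical in
/-- The subspaces covering `E` partition the vectors outside `E`. -/
theorem sum_ncard_inter_diff [Fintype F] [Fintype (Submodule F V)] (E : Submodule F V)
    (X : Set V) :
    ∑ H : Submodule F V with E ≤ H ∧ finrank F H = finrank F E + 1, (X ∩ (H \ E)).ncard =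
      (X \ E).ncard := by
  have := Module.finite_of_finite F (M := V)
  have := Fintype.ofFinite V
  rw [Set.ncard_eq_toFinset_card' (X \ E), Finset.card_eq_sum_card_fiberwise
    (f := fun v => E ⊔ Submodule.span F {v})
    (t := {H : Submodule F V | E ≤ H ∧ finrank F H = finrank F E + 1})]
  · refine Finset.sum_congr rfl fun H hH => ?_
    obtain ⟨hEH, hH⟩ := (Finset.mem_filter.1 hH).2
    rw [Set.ncard_eq_toFinset_card']
    congr 1
    ext v
    simp only [Set.mem_toFinset, Set.mem_inter_iff, Set.mem_sdiff, SetLike.mem_coe,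
      Finset.mem_filter]
    constructor
    · rintro ⟨hX, hvH, hvE⟩
      refine ⟨⟨hX, hvE⟩, Submodule.eq_of_le_of_finrank_eq ?_ ?_⟩
      · exact sup_le hEH (by simpa using hvH)
      · rw [finrank_sup_span_singleton E hvE, hH]
    · rintro ⟨⟨hX, hvE⟩, rfl⟩
      exact ⟨hX, Submodule.mem_sup_right (Submodule.mem_span_singleton_self v), hvE⟩
  · intro v hv
    have hv : v ∈ X ∧ v ∉ E := by simpa using hv
    simp [finrank_sup_span_singleton E hv.2]

open Classical in
theorem card_covers_of_codim_two [Fintype F] [Fintype (Submodule F V)] (E : Submodule F V)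
    (hE : finrank F V = finrank F E + 2) :
    ({H : Submodule F V | E ≤ H ∧ finrank F H = finrank F E + 1} : Finset _).card =
      Fintype.card F + 1 := by
  have := Module.finite_of_finite F (M := V)
  have hq : 1 < Fintype.card F := Fintype.one_lt_card
  have h := sum_ncard_inter_diff E (Set.univ : Set V)
  have htop := ncard_coe_submodule (⊤ : Submodule F V)
  rw [finrank_top, Submodule.top_coe] at htop
  rw [Set.ncard_sdiff (Set.subset_univ _), ncard_coe_submodule, htop, hE,
    Finset.sum_congr rfl (g := fun _ => (Fintype.card F - 1) * Fintype.card F ^ finrank F E),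
    Finset.sum_const, smul_eq_mul] at h
  · obtain ⟨r, hr⟩ : ∃ r, Fintype.card F = r + 1 := ⟨_, (Nat.succ_pred_eq_of_pos (by omega)).symm⟩
    rw [hr, Nat.add_sub_cancel] at h
    have hpos : 0 < r * (r + 1) ^ finrank F E := Nat.mul_pos (by omega) (by positivity)
    refine Nat.eq_of_mul_eq_mul_right hpos ?_
    rw [h, hr, Nat.sub_eq_of_eq_add]
    ring
  · intro H hH
    obtain ⟨hEH, hH⟩ := (Finset.mem_filter.1 hH).2
    rw [Set.univ_inter, Set.ncard_sdiff hEH, ncard_coe_submodule, ncard_coe_submodule, hH,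
      Nat.sub_mul, pow_succ, one_mul, mul_comm]

/-- Let `X` be a cone with `δ (q + 1)` points meeting each hyperplane `H` in `δ + k H * q` points.
Then the excesses `k H` over the hyperplanes `H` through a subspace `E` of codimension two sum to
the number of points of `X` on `E`. -/
theorem sum_excess_eq [Fintype F] [Fintype (Submodule F V)] (X : Set V) (δ : ℕ)
    (hX : X.ncard = (Fintype.card F - 1) * (δ * (Fintype.card F + 1))) (k : Submodule F V → ℕ)
    (E : Submodule F V) (hE : finrank F V = finrank F E + 2)
    (hk : ∀ H : Submodule F V, finrank F H = finrank F E + 1 →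
      (X ∩ H).ncard = (Fintype.card F - 1) * (δ + k H * Fintype.card F)) :
    open Classical in
    (Fintype.card F - 1) * ∑ H : Submodule F V with E ≤ H ∧ finrank F H = finrank F E + 1, k H =
      (X ∩ E).ncard := by
  classical
  have := Module.finite_of_finite F (M := V)
  have hsum := sum_ncard_inter_diff E X
  have hcardX := Set.ncard_inter_add_ncard_sdiff_eq_ncard X (E : Set V)
  have hsum' : ∑ H : Submodule F V with E ≤ H ∧ finrank F H = finrank F E + 1,
      ((X ∩ (H \ E)).ncard + (X ∩ E).ncard) =
      ∑ H : Submodule F V with E ≤ H ∧ finrank F H = finrank F E + 1,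
        (Fintype.card F - 1) * (δ + k H * Fintype.card F) := by
    refine Finset.sum_congr rfl fun H hH => ?_
    obtain ⟨hEH, hH⟩ := (Finset.mem_filter.1 hH).2
    have hXE : X ∩ H ∩ (E : Set V) = X ∩ E := by
      rw [Set.inter_assoc, Set.inter_eq_right.2 (show (E : Set V) ⊆ H from hEH)]
    rw [← hk H hH, ← Set.ncard_inter_add_ncard_sdiff_eq_ncard (X ∩ H) (E : Set V), hXE,
      Set.inter_sdiff_assoc, add_comm]
  rw [Finset.sum_add_distrib, hsum, Finset.sum_const, card_covers_of_codim_two E hE,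
    ← Finset.mul_sum, Finset.sum_add_distrib, Finset.sum_const, card_covers_of_codim_two E hE,
    ← Finset.sum_mul, smul_eq_mul, smul_eq_mul] at hsum'
  refine Nat.eq_of_mul_eq_mul_right (Fintype.card_pos (α := F)) ?_
  nlinarith

end HyperplanePencil

section Holes

variable {n : ℕ} {S : Set (Submodule F (Fin n → F))}

/-- The nonzero vectors spanning points not covered by any member of `S`. -/
def holes (S : Set (Submodule F (Fin n → F))) : Set (Fin n → F) :=
  {v | v ≠ 0 ∧ ∀ l ∈ S, v ∉ l}

theorem isPointCone_holes (S : Set (Submodule F (Fin n → F))) : IsPointCone F (holes S) where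
  zero_notMem h := h.1 rfl
  smul_mem _ _ ha hv :=
    ⟨smul_ne_zero ha hv.1, fun l hl h => hv.2 l hl ((l.smul_mem_iff ha).1 h)⟩

open Classical in
theorem ncard_holes_inter_add_sum [Fintype F] [Fintype (Submodule F (Fin n → F))]
    (hS : IsPartialLineSpread F n S) (W : Submodule F (Fin n → F)) :
    (holes S ∩ W).ncard + ∑ l ∈ S.toFinset, (Fintype.card F ^ finrank F ↥(l ⊓ W) - 1) =
      Fintype.card F ^ finrank F W - 1 := by
  have hcover : ((W : Set (Fin n → F)) \ {0}).toFinset =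
      (holes S ∩ W).toFinset ∪
        S.toFinset.biUnion fun l =>
          (((l ⊓ W : Submodule F (Fin n → F)) : Set _) \ {0}).toFinset := by
    ext v
    have hmem : v ∈ holes S ↔ v ≠ 0 ∧ ∀ l ∈ S, v ∉ l := Iff.rfl
    simp only [hmem, Set.mem_toFinset, Set.mem_sdiff, SetLike.mem_coe, Set.mem_singleton_iff,
      Finset.mem_union, Set.mem_inter_iff, Finset.mem_biUnion, Submodule.mem_inf]
    by_cases hv : ∃ l ∈ S, v ∈ l
    · grind
    · grind
  rw [← ncard_diff_zero W, Set.ncard_eq_toFinset_card' ((W : Set (Fin n → F)) \ {0}), hcover,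
    Finset.card_union_of_disjoint, Finset.card_biUnion, ← Set.ncard_eq_toFinset_card']
  · congr 1
    refine Finset.sum_congr rfl fun l _ => ?_
    rw [← ncard_diff_zero (l ⊓ W), Set.ncard_eq_toFinset_card']
  · intro l hl l' hl' hne
    have hdisj := hS.2 l (by simpa using hl) l' (by simpa using hl') hne
    refine Finset.disjoint_left.2 fun v hv hv' => ?_
    simp only [Set.mem_toFinset, Set.mem_sdiff, SetLike.mem_coe, Submodule.mem_inf,
      Set.mem_singleton_iff] at hv hv'
    exact hv.2 ((Submodule.mem_bot F).1 (hdisj ▸ Submodule.mem_inf.2 ⟨hv.1.1, hv'.1.1⟩))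
  · refine Finset.disjoint_left.2 fun v hv hv' => ?_
    obtain ⟨l, hl, hvl⟩ := Finset.mem_biUnion.1 hv'
    simp only [Set.mem_toFinset, Set.mem_sdiff, SetLike.mem_coe, Submodule.mem_inf,
      Set.mem_inter_iff] at hv hl hvl
    exact hv.1.2 l hl hvl.1.1

theorem ncard_holes_add [Fintype F] (hS : IsPartialLineSpread F n S) :
    (holes S).ncard + S.ncard * (Fintype.card F ^ 2 - 1) = Fintype.card F ^ n - 1 := by
  classical
  have := Fintype.ofFinite (Submodule F (Fin n → F))
  have h := ncard_holes_inter_add_sum hS ⊤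
  rw [Finset.sum_congr rfl (g := fun _ => Fintype.card F ^ 2 - 1), Finset.sum_const,
    ← Set.ncard_eq_toFinset_card'] at h
  · simpa using h
  · intro l hl
    rw [inf_top_eq, hS.1 l (by simpa using hl)]

/-- A hyperplane meets each line of `S` in a point, or contains it. -/
theorem exists_ncard_holes_inter_hyperplane [Fintype F] (hS : IsPartialLineSpread F n S)
    (H : Submodule F (Fin n → F)) (hH : finrank F H + 1 = n) :
    ∃ s : ℕ, (holes S ∩ H).ncard + S.ncard * (Fintype.card F - 1) +
      s * (Fintype.card F * (Fintype.card F - 1)) = Fintype.card F ^ finrank F H - 1 := by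
  classical
  have := Fintype.ofFinite (Submodule F (Fin n → F))
  have h := ncard_holes_inter_add_sum hS H
  have hterm : ∀ l ∈ S.toFinset, Fintype.card F ^ finrank F ↥(l ⊓ H) - 1 =
      (Fintype.card F - 1) + if l ≤ H then Fintype.card F * (Fintype.card F - 1) else 0 := by
    intro l hl
    have hl2 := hS.1 l (by simpa using hl)
    split_ifs with hlH
    · rw [inf_eq_left.2 hlH, hl2]
      obtain ⟨r, hr⟩ : ∃ r, Fintype.card F = r + 1 :=
        ⟨_, (Nat.succ_pred_eq_of_pos Fintype.card_pos).symm⟩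
      rw [hr, Nat.add_sub_cancel, Nat.sub_eq_of_eq_add]
      ring
    · have h1 := Submodule.finrank_lt_finrank_of_lt (inf_lt_left.2 hlH)
      have h2 := Submodule.finrank_sup_add_finrank_inf_eq l H
      have h3 := Submodule.finrank_le (l ⊔ H)
      rw [finrank_fin_fun] at h3
      rw [show finrank F ↥(l ⊓ H) = 1 by omega, pow_one, add_zero]
  refine ⟨(S.toFinset.filter fun l => l ≤ H).card, ?_⟩
  rw [← h, Finset.sum_congr rfl hterm, Finset.sum_add_distrib, Finset.sum_const,
    ← Finset.sum_filter, Finset.sum_const, ← Set.ncard_eq_toFinset_card', smul_eq_mul,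
    smul_eq_mul, add_assoc]

end Holes

/-- The hyperplane sections of a cone of holes, as a statement about integers: the line count `s`
of the hyperplane determines the number `x` of hole vectors in it. -/
theorem exists_excess_of_count {r m δ x s c : ℕ} (hδ : δ ≤ r)
    (hc : (c + δ) * ((r + 1) ^ 2 - 1) = (r + 1) ^ (2 * m + 2) - 1)
    (hx : x + c * r + s * ((r + 1) * r) = (r + 1) ^ (2 * m + 1) - 1) (hr : 0 < r) :
    ∃ k, x = r * (δ + k * (r + 1)) := by
  obtain ⟨t, ht⟩ : (r + 1) ^ 2 - 1 ∣ ((r + 1) ^ 2) ^ m - 1 := Nat.sub_one_dvd_pow_sub_one _ _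
  have hq2 : (r + 1) ^ 2 - 1 = r * (r + 2) := Nat.sub_eq_of_eq_add (by ring)
  have ht' : ((r + 1) ^ 2) ^ m = r * (r + 2) * t + 1 := by
    have := Nat.one_le_pow m ((r + 1) ^ 2) (by positivity)
    rw [hq2] at ht
    omega
  have hp1 : (r + 1) ^ (2 * m + 1) = (r * (r + 2) * t + 1) * (r + 1) := by
    rw [pow_succ, pow_mul, ht']
  have hp2 : (r + 1) ^ (2 * m + 2) = (r * (r + 2) * t + 1) * (r + 1) ^ 2 := by
    rw [pow_add, pow_mul, ht']
  have hc1 : (c + δ) * (r * (r + 2)) + 1 = (r * (r + 2) * t + 1) * (r + 1) ^ 2 := by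
    rw [hq2] at hc
    rw [← hp2, hc]
    exact Nat.sub_add_cancel (Nat.one_le_pow _ _ (by omega))
  have hx1 : x + c * r + s * ((r + 1) * r) + 1 = (r * (r + 2) * t + 1) * (r + 1) := by
    rw [← hp1, hx]
    exact Nat.sub_add_cancel (Nat.one_le_pow _ _ (by omega))
  have hkey : (x : ℤ) = r * (δ + (t - s) * (r + 1)) := by
    have hr2 : ((r : ℤ) + 2) ≠ 0 := by positivity
    apply mul_left_cancel₀ hr2
    zify at hc1 hx1
    linear_combination (r + 2 : ℤ) * hx1 - hc1
  have hst : s ≤ t := by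
    by_contra! hlt
    have h1 : (t : ℤ) - s ≤ -1 := by omega
    have h2 : (δ : ℤ) + (t - s) * (r + 1) < 0 := by nlinarith
    have h3 : (0 : ℤ) < r := by omega
    nlinarith
  obtain ⟨k, rfl⟩ := Nat.exists_eq_add_of_le hst
  refine ⟨k, ?_⟩
  zify
  rw [hkey]
  push_cast
  ring

end VectorCones

/-- (Govaerts–Storme) Let q > 2 be a prime power, let q + ε be the size of the
smallest non-trivial blocking set in PG(2,q), and N ≥ 3 odd. Then there is no
maximal partial line spread of PG(N,q) of deficiency δ with 0 < δ < ε. -/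
theorem stmt19 (F : Type*) [Field F] [Fintype F] (q ε : ℕ)
    (hq : Fintype.card F = q) (hq2 : 2 < q)
    (hε : IsLeast {n : ℕ | ∃ B : Set (Submodule F (Fin 3 → F)),
      IsNontrivialBlockingSet F B ∧ B.ncard = n} (q + ε))
    (N : ℕ) (hN3 : 3 ≤ N) (hNodd : Odd N)
    (S : Set (Submodule F (Fin (N + 1) → F)))
    (hS : IsMaximalPartialLineSpread F (N + 1) S)
    (δ : ℕ) (hδpos : 0 < δ) (hδε : δ < ε)
    (hdef : S.ncard + δ = (q ^ (N + 1) - 1) / (q ^ 2 - 1)) :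
    False := by
  classical
  subst hq
  have hmin : ∀ B : Set (Submodule F (Fin 3 → F)), IsNontrivialBlockingSet F B →
      Fintype.card F + ε ≤ B.ncard := fun B hB => hε.2 ⟨B, hB, rfl⟩
  have hεq : ε ≤ Fintype.card F := by
    obtain ⟨B, hB, hcard⟩ := exists_isNontrivialBlockingSet_ncard_le hq2
    have := hmin B hB
    omega
  obtain ⟨r, hr⟩ : ∃ r, Fintype.card F = r + 1 := ⟨_, (Nat.succ_pred_eq_of_pos (by omega)).symm⟩
  obtain ⟨m, rfl⟩ := hNodd
  have := Fintype.ofFinite (Submodule F (Fin (2 * m + 1 + 1) → F))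
  have hS' := hS.1
  have hc : (S.ncard + δ) * ((r + 1) ^ 2 - 1) = (r + 1) ^ (2 * m + 2) - 1 := by
    rw [hdef, hr]
    refine Nat.div_mul_cancel ?_
    rw [show 2 * m + 1 + 1 = 2 * (m + 1) by ring, pow_mul]
    exact Nat.sub_one_dvd_pow_sub_one _ _
  have hX : (holes S).ncard = r * (δ * (r + 2)) := by
    have h := ncard_holes_add hS'
    rw [hr, ← hc, add_mul, add_comm, Nat.add_left_cancel_iff] at h
    rw [h, show (r + 1) ^ 2 = r * (r + 2) + 1 by ring, Nat.add_sub_cancel]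
    ring
  have hexcess : ∀ H : Submodule F (Fin (2 * m + 1 + 1) → F), finrank F H = 2 * m + 1 →
      ∃ k, (holes S ∩ H).ncard = r * (δ + k * (r + 1)) := by
    intro H hH
    obtain ⟨s, hs⟩ := exists_ncard_holes_inter_hyperplane hS' H (by omega)
    rw [hr, hH, Nat.add_sub_cancel] at hs
    exact exists_excess_of_count (by omega) hc hs (by omega)
  choose! k hk using hexcess
  have hsum : ∀ E : Submodule F (Fin (2 * m + 1 + 1) → F), finrank F E = 2 * m →
      r * ∑ H : Submodule F (Fin (2 * m + 1 + 1) → F) with E ≤ H ∧ finrank F H = finrank F E + 1,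
        k H = (holes S ∩ E).ncard := by
    intro E hE
    have h := sum_excess_eq (holes S) δ (by rw [hX, hr, Nat.add_sub_cancel]) k E
      (by rw [finrank_fin_fun, hE]) (fun H hH => by
        rw [hr, Nat.add_sub_cancel]
        exact hk H (by omega))
    rw [hr, Nat.add_sub_cancel] at h
    exact h
  obtain ⟨p, hp⟩ : (holes S).Nonempty := by
    refine Set.nonempty_of_ncard_ne_zero ?_
    rw [hX]
    have : 0 < r := by omega
    positivity
  have hX0 := isPointCone_holes S
  let U := Submodule.span F {p}
  have hU : finrank F U = 1 := finrank_span_singleton hp.1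
  have hcone : IsPointCone F (holes S \ U) :=
    ⟨fun h => hX0.zero_notMem h.1, fun a v ha hv =>
      ⟨hX0.smul_mem a v ha hv.1, fun h => hv.2 ((U.smul_mem_iff ha).1 h)⟩⟩
  obtain ⟨E', hE', hE'X⟩ := (hcone.image_mkQ U fun v hv => hv.2).exists_submodule_avoiding 2
    (2 * m - 1) (finrank_quotient_eq U (by rw [finrank_fin_fun]; omega) hU) (by
      have h1 : (U.mkQ '' (holes S \ U)).ncard ≤ (holes S \ U).ncard := Set.ncard_image_le
      have h2 : (holes S \ U).ncard ≤ (holes S).ncard := Set.ncard_le_ncard Set.sdiff_subset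
      refine (h1.trans h2).trans_lt ?_
      rw [hX, hr]
      apply Nat.lt_sub_of_add_lt
      have hδr : δ ≤ r := by omega
      have hr0 : 0 < r := by omega
      calc r * (δ * (r + 2)) + 1 ≤ r * (r * (r + 2)) + 1 := by gcongr
        _ < r * (r * (r + 2)) + 1 + (r * r + 3 * r) := Nat.lt_add_of_pos_right (by positivity)
        _ = (r + 1) ^ (2 + 1) := by ring)
  let E := E'.comap U.mkQ
  have hE : finrank F E = 2 * m := by
    rw [finrank_comap_mkQ, hE', hU]
    omega
  have hEX : holes S ∩ E = (U : Set _) \ {0} := by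
    ext v
    constructor
    · rintro ⟨hv, hvE⟩
      refine ⟨?_, hv.1⟩
      by_contra hvU
      exact hE'X _ ⟨v, ⟨hv, hvU⟩, rfl⟩ hvE
    · rintro ⟨hvU, hv0⟩
      obtain ⟨a, rfl⟩ := Submodule.mem_span_singleton.1 hvU
      exact ⟨hX0.smul_mem a p (fun h => hv0 (by simp [h])) hp, U.le_comap_mkQ E' hvU⟩
  have hk1 := hsum E hE
  rw [hEX, ncard_diff_zero, hU, pow_one, hr, Nat.add_sub_cancel] at hk1
  replace hk1 := Nat.eq_of_mul_eq_mul_left (by omega : 0 < r) (hk1.trans (mul_one r).symm)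
  obtain ⟨H, hH, hkH⟩ := Finset.exists_ne_zero_of_sum_ne_zero (hk1.trans_ne one_ne_zero)
  have hkle := (Finset.single_le_sum (f := k) (fun _ _ => Nat.zero_le _) hH).trans_eq hk1
  have hkH1 : k H = 1 := by omega
  have hHr : finrank F H = 2 * m + 1 := by
    rw [(Finset.mem_filter.1 hH).2.2, hE]
  obtain ⟨W, hW, hWX⟩ := IsPointCone.exists_line_of_blocks_hyperplanes hmin hεq (2 * m - 2)
    (hX0.comap_subtype H) (by omega) (fun D hD => by
      by_contra! hno
      let D' := D.map H.subtype
      have hD' : finrank F D' = 2 * m := by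
        rw [Submodule.finrank_map_subtype_eq, hD]
        omega
      have hD'X : holes S ∩ D' = ∅ := by
        refine Set.eq_empty_of_forall_notMem ?_
        rintro _ ⟨hv, u, hu, rfl⟩
        exact hno u hv hu
      have h := hsum D' hD'
      rw [hD'X, Set.ncard_empty] at h
      have h0 := Finset.sum_eq_zero_iff.1 ((Nat.mul_eq_zero.1 h).resolve_left (by omega)) H
        (Finset.mem_filter.2 ⟨Finset.mem_univ _, Submodule.map_subtype_le H D, by omega⟩)
      omega)
    (by
      rw [IsPointCone.ncard_preimage_subtype, hk H hHr, hkH1, hr, Nat.add_sub_cancel]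
      exact Nat.mul_lt_mul_of_pos_left (by omega) (by omega))
  obtain ⟨l, hl, hWl⟩ := hS.2 (W.map H.subtype) (by rw [Submodule.finrank_map_subtype_eq, hW])
  obtain ⟨v, hv, hv0⟩ := Submodule.exists_mem_ne_zero_of_ne_bot hWl
  obtain ⟨⟨w, hw, rfl⟩, hvl⟩ := Submodule.mem_inf.1 hv
  exact (hWX w hw (by simpa using hv0)).2 l hl hvl
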